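/- arXiv:2408.08123 — 5 statements merged into one kernel-verified Lean document; each statement's English description precedes it below -/
import Mathlib

section
/- Let V and P be real Hilbert spaces and D ⊆ V. For each v ∈ D let A_v be a bounded linear operator on P and b_v ∈ P, such that v ↦ b_v is L_b-Lipschitz on D and ‖A_v − A_ṽ‖ ≤ L_A‖v − ṽ‖ for all v, ṽ ∈ D. Suppose for each v ∈ D a splitting A_v = N_v + M_v is given with N_v bounded linear and invertible, satisfying ‖N_v⁻¹ M_v‖ ≤ ζ for some ζ ∈ [0, 1) and γ_N‖N_v⁻¹‖ ≤ 1 for some γ_N > 0. Let v, v̄ ∈ D and p, p̄, p̆ ∈ P satisfy N_v p̆ + M_v p = b_v and A_{v̄} p̄ = b_{v̄}. Then ζ‖p − p̄‖ ≥ ‖p̆ − p̄‖ − (L_A‖p̄‖ + L_b)·γ_N⁻¹·‖v − v̄‖. -/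
/-- Lemma 4.1: perturbed contractivity of linear-system splitting methods.
Let `V`, `P` be real Hilbert spaces, `D ⊆ V`.  For `v ∈ D` let `A v` be a bounded linear
operator on `P` and `b v ∈ P`, with `v ↦ b v` `L_b`-Lipschitz and `v ↦ A v` `L_A`-Lipschitz
on `D`.  Suppose `A v = N v + M v` with `N v` invertible, `‖(N v)⁻¹ M v‖ ≤ ζ ∈ [0,1)` and
`γ_N ‖(N v)⁻¹‖ ≤ 1` on `D`.  If `N v p̆ + M v p = b v` and `A v̄ p̄ = b v̄` for `v, v̄ ∈ D`,
then `ζ‖p − p̄‖ ≥ ‖p̆ − p̄‖ − (L_A‖p̄‖ + L_b) γ_N⁻¹ ‖v − v̄‖`. -/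
theorem splitting_tracking_estimate
    {V P : Type*} [NormedAddCommGroup V] [InnerProductSpace ℝ V]
    [NormedAddCommGroup P] [InnerProductSpace ℝ P]
    (D : Set V)
    (A M : V → (P →L[ℝ] P)) (N : V → (P ≃L[ℝ] P)) (b : V → P)
    (Lb LA ζ γN : ℝ) (hζ0 : 0 ≤ ζ) (hζ1 : ζ < 1) (hγN : 0 < γN)
    (hb : ∀ v ∈ D, ∀ w ∈ D, ‖b v - b w‖ ≤ Lb * ‖v - w‖)
    (hA : ∀ v ∈ D, ∀ w ∈ D, ‖A v - A w‖ ≤ LA * ‖v - w‖)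
    (hsplit : ∀ v ∈ D, A v = (N v : P →L[ℝ] P) + M v)
    (hNM : ∀ v ∈ D, ‖((N v).symm : P →L[ℝ] P) ∘L M v‖ ≤ ζ)
    (hγ : ∀ v ∈ D, γN * ‖((N v).symm : P →L[ℝ] P)‖ ≤ 1)
    (v vbar : V) (hv : v ∈ D) (hvbar : vbar ∈ D)
    (p pbar pbreve : P)
    (hstep : N v pbreve + M v p = b v)
    (hsol : A vbar pbar = b vbar) :
    ζ * ‖p - pbar‖ ≥ ‖pbreve - pbar‖ - (LA * ‖pbar‖ + Lb) * γN⁻¹ * ‖v - vbar‖ := by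
  set S : P →L[ℝ] P := ((N v).symm : P →L[ℝ] P) with hS
  set r : P := (b v - b vbar) - (A v - A vbar) pbar with hr
  have hr_le : ‖r‖ ≤ (LA * ‖pbar‖ + Lb) * ‖v - vbar‖ :=
    calc ‖r‖ ≤ ‖b v - b vbar‖ + ‖(A v - A vbar) pbar‖ := norm_sub_le _ _
      _ ≤ Lb * ‖v - vbar‖ + LA * ‖v - vbar‖ * ‖pbar‖ :=
        add_le_add (hb v hv vbar hvbar)
          ((A v - A vbar).le_of_opNorm_le (hA v hv vbar hvbar) pbar)
      _ = (LA * ‖pbar‖ + Lb) * ‖v - vbar‖ := by ring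
  have hN : N v (pbreve - pbar) = r - M v (p - pbar) := by
    have hAv : A v pbar = N v pbar + M v pbar := by simp [hsplit v hv]
    rw [hr, ← hstep, ← hsol, sub_apply, hAv, map_sub, map_sub]
    abel
  have herr : pbreve - pbar = S r - (S ∘L M v) (p - pbar) := by
    rw [ContinuousLinearMap.comp_apply, ← map_sub, ← hN]
    simp [hS]
  have hS_le : ‖S‖ ≤ γN⁻¹ := by
    rw [← one_div, le_div_iff₀' hγN]
    exact hγ v hv
  have hSr : ‖S r‖ ≤ γN⁻¹ * ((LA * ‖pbar‖ + Lb) * ‖v - vbar‖) :=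
    (S.le_of_opNorm_le hS_le r).trans (by gcongr)
  have hSM := (S ∘L M v).le_of_opNorm_le (hNM v hv) (p - pbar)
  have hmain := norm_sub_le (S r) ((S ∘L M v) (p - pbar))
  rw [← herr] at hmain
  linarith
end

section
/- Let a, b, c, d > 0 be real numbers and, for η₁, η₂ > 0, define f₁(η₁, η₂) := (1 + 1/η₁ + (1 + 1/η₂)a²)·b² and f₂(η₁, η₂) := (1 + η₁)c² + (1 + η₂)d². Suppose ζ ∈ [0, 1) satisfies d² + abd + b²(1 + c)(1 + a²) + c² + bc ≤ ζ². Then there exists η₁* > 0 such that f₁(η₁*, (ac/d)·η₁*) = f₂(η₁*, (ac/d)·η₁*) ≤ ζ². -/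
/-- A decreasing hyperbola `B + b²S/t` and an increasing line `A + St` cross at some `t > 0`,
and the common value is at most their larger value at `t = b`. -/
theorem exists_pos_hyperbola_eq_line_le {A B S b M : ℝ} (hS : 0 < S) (hb : 0 < b)
    (hA : A + S * b ≤ M) (hB : B + S * b ≤ M) :
    ∃ t : ℝ, 0 < t ∧ B + b ^ 2 * S / t = A + S * t ∧ A + S * t ≤ M := by
  set D := (B - A) ^ 2 + 4 * S ^ 2 * b ^ 2
  have hD : 0 < 4 * S ^ 2 * b ^ 2 := by positivity
  have hsq : √D ^ 2 = D := Real.sq_sqrt (by positivity)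
  have hlt : |B - A| < √D := Real.lt_sqrt_of_sq_lt (by rw [sq_abs]; exact lt_add_of_pos_right _ hD)
  have hpos : 0 < (B - A + √D) / (2 * S) :=
    div_pos (by linarith [neg_abs_le (B - A)]) (by positivity)
  obtain ⟨t, ht⟩ : ∃ t, t = (B - A + √D) / (2 * S) := ⟨_, rfl⟩
  rw [← ht] at hpos
  have hroot : √D = 2 * S * t - (B - A) := by
    rw [ht]; field_simp; ring
  have hquad : B * t + b ^ 2 * S = (A + S * t) * t := by
    rw [hroot] at hsq
    refine mul_left_cancel₀ (mul_pos four_pos hS).ne' ?_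
    linear_combination -hsq
  refine ⟨t, hpos, by field_simp; linarith, ?_⟩
  rcases le_total t b with htb | htb
  · linarith [mul_le_mul_of_nonneg_left htb hS.le]
  · refine le_trans (le_of_mul_le_mul_right ?_ hpos) hB
    nlinarith [mul_le_mul_of_nonneg_left htb (mul_pos hS hb).le]

/-- Lemma C.2. Let `a, b, c, d > 0` and, for `η₁, η₂ > 0`, set
`f₁(η₁, η₂) := (1 + 1/η₁ + (1 + 1/η₂)a²)b²` and `f₂(η₁, η₂) := (1 + η₁)c² + (1 + η₂)d²`.
If `ζ ∈ [0, 1)` satisfies `d² + abd + b²(1 + c)(1 + a²) + c² + bc ≤ ζ²`, then there is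
`η₁* > 0` with `f₁(η₁*, (ac/d)η₁*) = f₂(η₁*, (ac/d)η₁*) ≤ ζ²`. -/
theorem exists_eta_eq_le (a b c d ζ : ℝ) (ha : 0 < a) (hb : 0 < b) (hc : 0 < c) (hd : 0 < d)
    (hζ0 : 0 ≤ ζ) (hζ1 : ζ < 1)
    (h : d ^ 2 + a * b * d + b ^ 2 * (1 + c) * (1 + a ^ 2) + c ^ 2 + b * c ≤ ζ ^ 2) :
    ∃ η : ℝ, 0 < η ∧
      (1 + 1 / η + (1 + 1 / (a * c / d * η)) * a ^ 2) * b ^ 2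
        = (1 + η) * c ^ 2 + (1 + a * c / d * η) * d ^ 2 ∧
      (1 + η) * c ^ 2 + (1 + a * c / d * η) * d ^ 2 ≤ ζ ^ 2 := by
  have hb2 : 0 < b ^ 2 * c * (1 + a ^ 2) := by positivity
  have hba : 0 < b ^ 2 * (1 + a ^ 2) := by positivity
  obtain ⟨t, ht, heq, hle⟩ := exists_pos_hyperbola_eq_line_le
    (A := c ^ 2 + d ^ 2) (B := b ^ 2 * (1 + a ^ 2)) (S := c + a * d) (b := b) (M := ζ ^ 2)
    (by positivity) hb (by linarith) (by linarith [sq_nonneg c, sq_nonneg d])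
  have hf₁ : (1 + 1 / (t / c) + (1 + 1 / (a * c / d * (t / c))) * a ^ 2) * b ^ 2
      = b ^ 2 * (1 + a ^ 2) + b ^ 2 * (c + a * d) / t := by
    field_simp; ring
  have hf₂ : (1 + t / c) * c ^ 2 + (1 + a * c / d * (t / c)) * d ^ 2
      = c ^ 2 + d ^ 2 + (c + a * d) * t := by
    field_simp; ring
  exact ⟨t / c, div_pos ht hc, by rw [hf₁, hf₂, heq], by rw [hf₂]; exact hle⟩
end

section
/- Let β, σ > 0 and define R : ℝ⁴ → ℝ ∪ {∞} by R(α) = β(α₂ + α₃ + α₄ − 1)² if α₁ ≥ 0 and R(α) = ∞ if α₁ < 0. Then for every ã ∈ ℝ⁴, the unique minimizer of α ↦ (1/2)‖α − ã‖² + σR(α) is (max{0, ã₁}, α₂, α₃, α₄), where (α₂, α₃, α₄) is the unique solution of the linear system α_j + 2σβ(α₂ + α₃ + α₄) = ã_j + 2σβ for j = 2, 3, 4. -/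
/-- The linear system `v_j + c * (v₁ + v₂ + v₃) = b_j` with `c > 0` has exactly one solution. -/
theorem existsUnique_add_mul_sum_eq {c : ℝ} (hc : 0 < c) (b₁ b₂ b₃ : ℝ) :
    ∃! v : ℝ × ℝ × ℝ,
      v.1 + c * (v.1 + v.2.1 + v.2.2) = b₁ ∧
      v.2.1 + c * (v.1 + v.2.1 + v.2.2) = b₂ ∧
      v.2.2 + c * (v.1 + v.2.1 + v.2.2) = b₃ := by
  have h : 1 + 3 * c ≠ 0 := by positivity
  set s := (b₁ + b₂ + b₃) / (1 + 3 * c) with hs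
  have hs' : s * (1 + 3 * c) = b₁ + b₂ + b₃ := div_mul_cancel₀ _ h
  refine ⟨(b₁ - c * s, b₂ - c * s, b₃ - c * s), ?_, ?_⟩
  · have hsum : b₁ - c * s + (b₂ - c * s) + (b₃ - c * s) = s := by linarith
    simp only [hsum]
    exact ⟨by ring, by ring, by ring⟩
  · rintro ⟨x, y, z⟩ ⟨h₁, h₂, h₃⟩
    dsimp only at h₁ h₂ h₃
    have hsum : x + y + z = s := by
      rw [hs, eq_div_iff h]
      linarith
    rw [hsum] at h₁ h₂ h₃
    simp only [Prod.mk.injEq]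
    exact ⟨by linarith, by linarith, by linarith⟩

/-- The variational inequality for the projection of `t` onto `[0, ∞)`. -/
theorem sub_max_zero_mul_nonneg {x : ℝ} (hx : 0 ≤ x) (t : ℝ) :
    0 ≤ (x - max 0 t) * (max 0 t - t) := by
  rcases le_total 0 t with ht | ht
  · simp [max_eq_right ht]
  · rw [max_eq_left ht]
    nlinarith

/-- Strict minimality of the proximal point among the points with nonnegative zeroth coordinate. -/
theorem prox_objective_lt {c : ℝ} (hc : 0 < c) {ta a z : EuclideanSpace ℝ (Fin 4)}
    (h₀ : a 0 = max 0 (ta 0))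
    (h₁ : a 1 + 2 * c * (a 1 + a 2 + a 3) = ta 1 + 2 * c)
    (h₂ : a 2 + 2 * c * (a 1 + a 2 + a 3) = ta 2 + 2 * c)
    (h₃ : a 3 + 2 * c * (a 1 + a 2 + a 3) = ta 3 + 2 * c)
    (hz : 0 ≤ z 0) (hne : z ≠ a) :
    1 / 2 * ‖a - ta‖ ^ 2 + c * (a 1 + a 2 + a 3 - 1) ^ 2
      < 1 / 2 * ‖z - ta‖ ^ 2 + c * (z 1 + z 2 + z 3 - 1) ^ 2 := by
  have hpos : 0 < ‖z - a‖ ^ 2 := pow_pos (norm_pos_iff.2 (sub_ne_zero.2 hne)) 2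
  have hvar : 0 ≤ (z 0 - a 0) * (a 0 - ta 0) := h₀ ▸ sub_max_zero_mul_nonneg hz (ta 0)
  have hsq : 0 ≤ c * (z 1 + z 2 + z 3 - (a 1 + a 2 + a 3)) ^ 2 := by positivity
  simp only [EuclideanSpace.real_norm_sq_eq, Fin.sum_univ_four, PiLp.sub_apply] at hpos ⊢
  linear_combination 1 / 2 * hpos + hvar + hsq - (z 1 - a 1) * h₁ - (z 2 - a 2) * h₂ -
    (z 3 - a 3) * h₃

/-- Lemma D.1: the outer proximal operator for the deblurring experiment.
For `R(α) = β(α₂ + α₃ + α₄ − 1)² + δ_{[0,∞)}(α₁)` on `ℝ⁴` and `σ, β > 0`, the linear system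
`α_j + 2σβ(α₂ + α₃ + α₄) = ã_j + 2σβ` (`j = 2, 3, 4`) has a unique solution, and
`prox_{σR}(ã) = (max{0, ã₁}, α₂, α₃, α₄)`, i.e. this point is the unique (strict) minimizer
of `α ↦ (1/2)‖α − ã‖² + σR(α)`. -/
theorem prox_deblur_outer_regulariser
    (β σ : ℝ) (hβ : 0 < β) (hσ : 0 < σ)
    (R : EuclideanSpace ℝ (Fin 4) → EReal)
    (hR : ∀ α : EuclideanSpace ℝ (Fin 4),
      R α = if 0 ≤ α 0 then ((β * (α 1 + α 2 + α 3 - 1) ^ 2 : ℝ) : EReal) else ⊤)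
    (ta : EuclideanSpace ℝ (Fin 4)) :
    (∃! v : ℝ × ℝ × ℝ,
        v.1 + 2 * σ * β * (v.1 + v.2.1 + v.2.2) = ta 1 + 2 * σ * β ∧
        v.2.1 + 2 * σ * β * (v.1 + v.2.1 + v.2.2) = ta 2 + 2 * σ * β ∧
        v.2.2 + 2 * σ * β * (v.1 + v.2.1 + v.2.2) = ta 3 + 2 * σ * β) ∧
      ∀ v : ℝ × ℝ × ℝ,
        (v.1 + 2 * σ * β * (v.1 + v.2.1 + v.2.2) = ta 1 + 2 * σ * β ∧
         v.2.1 + 2 * σ * β * (v.1 + v.2.1 + v.2.2) = ta 2 + 2 * σ * β ∧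
         v.2.2 + 2 * σ * β * (v.1 + v.2.1 + v.2.2) = ta 3 + 2 * σ * β) →
        ∀ αstar : EuclideanSpace ℝ (Fin 4),
          αstar 0 = max 0 (ta 0) → αstar 1 = v.1 → αstar 2 = v.2.1 → αstar 3 = v.2.2 →
          ∀ z : EuclideanSpace ℝ (Fin 4), z ≠ αstar →
            ((1 / 2 * ‖αstar - ta‖ ^ 2 : ℝ) : EReal) + (σ : EReal) * R αstar
              < ((1 / 2 * ‖z - ta‖ ^ 2 : ℝ) : EReal) + (σ : EReal) * R z := by
  have hc : 0 < σ * β := mul_pos hσ hβ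
  refine ⟨existsUnique_add_mul_sum_eq (by positivity) _ _ _, ?_⟩
  rintro ⟨v₁, v₂, v₃⟩ ⟨h₁, h₂, h₃⟩ a h₀ rfl rfl rfl z hne
  have ha : 0 ≤ a 0 := h₀ ▸ le_max_left _ _
  rw [hR, hR, if_pos ha, ← EReal.coe_mul, ← EReal.coe_add]
  split_ifs with hz
  · rw [← EReal.coe_mul, ← EReal.coe_add, EReal.coe_lt_coe_iff, ← mul_assoc, ← mul_assoc]
    simp only [mul_assoc 2 σ β] at h₁ h₂ h₃
    exact prox_objective_lt hc h₀ h₁ h₂ h₃ hz hne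
  · rw [EReal.coe_mul_top_of_pos hσ, EReal.coe_add_top]
    exact EReal.coe_lt_top _
end

section
/- Let n ≥ 1, let w ∈ ℝⁿ have all components w_i > 0, and let β, M, τ > 0. Define R : ℝⁿ → ℝ ∪ {∞} by R(α) = β·(wᵀα) if α_i ≥ 0 for all i and wᵀα ≤ M, and R(α) = ∞ otherwise. Fix ã ∈ ℝⁿ. For a subset ℐ ⊆ {1, …, n} set λ̃(ℐ) := max{((Σ_{i∈ℐ} w_i ã_i) − M) / (Σ_{i∈ℐ} w_i²), τβ}. Then: (a) there exists ℐ ⊆ {1, …, n} such that for every i, ã_i/w_i > λ̃(ℐ) implies i ∈ ℐ and ã_i/w_i < λ̃(ℐ) implies i ∉ ℐ; and (b) for any such ℐ, the unique minimizer α of z ↦ (1/2)‖z − ã‖² + τR(z) is given componentwise by α_i = max{0, ã_i − w_i·λ̃(ℐ)} for i = 1, …, n. -/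
open Finset in
/-- For `φ l = ∑ wᵢ max 0 (aᵢ - wᵢ l)` there is a threshold `l ≥ c` such that `φ l ≤ M`, with equality
unless `l = c`. -/
lemma exists_threshold {ι : Type*} [Fintype ι] (w a : ι → ℝ) (hw : ∀ i, 0 < w i) {M : ℝ}
    (hM : 0 < M) (c : ℝ) :
    ∃ l, c ≤ l ∧ ∑ i, w i * max 0 (a i - w i * l) ≤ M ∧
      (c < l → ∑ i, w i * max 0 (a i - w i * l) = M) := by
  rcases le_or_gt (∑ i, w i * max 0 (a i - w i * c)) M with h | h
  · exact ⟨c, le_rfl, h, fun hc => absurd hc (lt_irrefl _)⟩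
  · set L := max c (∑ i, |a i / w i|)
    have hL : ∑ i, w i * max 0 (a i - w i * L) = 0 := by
      refine sum_eq_zero fun i _ => ?_
      have h₁ : a i / w i ≤ L :=
        (le_abs_self _).trans <| (single_le_sum (f := fun j => |a j / w j|)
          (fun j _ => abs_nonneg _) (mem_univ i)).trans (le_max_right _ _)
      rw [div_le_iff₀ (hw i)] at h₁
      rw [max_eq_left (by linarith), mul_zero]
    have hcont : Continuous fun l => ∑ i, w i * max 0 (a i - w i * l) := by fun_prop
    obtain ⟨l, hl, hlM⟩ := intermediate_value_Icc' (le_max_left c _ : c ≤ L) hcont.continuousOn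
      (show M ∈ Set.Icc _ _ from ⟨hL.le.trans hM.le, h.le⟩)
    exact ⟨l, hl.1, hlM.le, fun _ => hlM⟩

/-- If `I` is consistent with the threshold `l`, the weighted sum of the soft-thresholded vector only
sees the indices in `I`. -/
lemma sum_mul_max_eq_of_consistent {ι : Type*} [Fintype ι] (w a : ι → ℝ) (hw : ∀ i, 0 < w i)
    (I : Finset ι) (l : ℝ) (hI : ∀ i, (a i / w i > l → i ∈ I) ∧ (a i / w i < l → i ∉ I)) :
    ∑ i, w i * max 0 (a i - w i * l) = ∑ i ∈ I, w i * a i - l * ∑ i ∈ I, w i ^ 2 := by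
  rw [Finset.mul_sum, ← Finset.sum_sub_distrib]
  symm
  refine (Finset.sum_congr rfl fun i hi => ?_).trans
    (Finset.sum_subset (Finset.subset_univ I) fun i _ hi => ?_)
  · have h := not_lt.1 fun h => (hI i).2 h hi
    rw [le_div_iff₀ (hw i)] at h
    rw [max_eq_right (by linarith)]
    ring
  · have h := not_lt.1 fun h => hi ((hI i).1 h)
    rw [div_le_iff₀ (hw i)] at h
    rw [max_eq_left (by linarith), mul_zero]

/-- A soft-thresholded vector satisfying complementary slackness strictly minimizes the objective
over the feasible set. -/
lemma objective_lt_of_complementary_slackness {ι : Type*} [Fintype ι] (w a α z : ι → ℝ)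
    {M c l : ℝ} (hα : ∀ i, α i = max 0 (a i - w i * l)) (hcl : c ≤ l)
    (hslack : c < l → ∑ i, w i * α i = M)
    (hz : ∀ i, 0 ≤ z i) (hzM : ∑ i, w i * z i ≤ M) (hne : z ≠ α) :
    1 / 2 * ∑ i, (α i - a i) ^ 2 + c * ∑ i, w i * α i
      < 1 / 2 * ∑ i, (z i - a i) ^ 2 + c * ∑ i, w i * z i := by
  have hpt : ∀ i, 1 / 2 * (α i - a i) ^ 2 + l * (w i * α i) + 1 / 2 * (z i - α i) ^ 2
      ≤ 1 / 2 * (z i - a i) ^ 2 + l * (w i * z i) := by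
    intro i
    have : 0 ≤ (α i - a i + w i * l) * (z i - α i) := by
      rw [hα i]
      rcases le_total 0 (a i - w i * l) with h | h
      · rw [max_eq_right h]
        exact le_of_eq (by ring)
      · rw [max_eq_left h]
        exact mul_nonneg (by linarith) (by linarith [hz i])
    linarith
  have hsum := Finset.sum_le_sum fun i (_ : i ∈ Finset.univ) => hpt i
  simp only [Finset.sum_add_distrib, ← Finset.mul_sum] at hsum
  obtain ⟨i, hi⟩ := Function.ne_iff.1 hne
  have hpos : 0 < ∑ i, (z i - α i) ^ 2 :=
    Finset.sum_pos' (fun _ _ => sq_nonneg _)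
      ⟨i, Finset.mem_univ i, sq_pos_of_ne_zero (sub_ne_zero.2 hi)⟩
  have hdual : (l - c) * (∑ i, w i * z i) ≤ (l - c) * ∑ i, w i * α i := by
    rcases hcl.eq_or_lt with h | h
    · simp [h]
    · rw [hslack h]
      exact mul_le_mul_of_nonneg_left hzM (by linarith)
  linarith


/-- (Lemma D.2: the outer proximal operator for the MRI sampling-pattern
regulariser `R(α) = β φ(wᵀα) + δ_{[0,∞)ⁿ}(α)`, `φ(t) = t + δ_{(−∞,M]}(t)`).
There exists an index set `ℐ` consistent with the threshold
`λ̃(ℐ) = max{((Σ_{i∈ℐ} wᵢãᵢ) − M)/Σ_{i∈ℐ} wᵢ², τβ}`, and for any such `ℐ` the unique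
minimizer of `z ↦ (1/2)‖z − ã‖² + τR(z)` is `αᵢ = max{0, ãᵢ − wᵢλ̃(ℐ)}`. -/
theorem prox_mri_outer_regulariser
    (n : ℕ) (hn : 1 ≤ n) (w : Fin n → ℝ) (hw : ∀ i, 0 < w i)
    (β M τ : ℝ) (hβ : 0 < β) (hM : 0 < M) (hτ : 0 < τ)
    (R : EuclideanSpace ℝ (Fin n) → EReal)
    (hR : ∀ α : EuclideanSpace ℝ (Fin n),
      R α = if (∀ i, 0 ≤ α i) ∧ (∑ i, w i * α i) ≤ M
        then ((β * ∑ i, w i * α i : ℝ) : EReal) else ⊤)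
    (ta : EuclideanSpace ℝ (Fin n)) :
    (∃ I : Finset (Fin n), ∀ i : Fin n,
        (ta i / w i > max (((∑ j ∈ I, w j * ta j) - M) / (∑ j ∈ I, w j ^ 2)) (τ * β)
          → i ∈ I) ∧
        (ta i / w i < max (((∑ j ∈ I, w j * ta j) - M) / (∑ j ∈ I, w j ^ 2)) (τ * β)
          → i ∉ I)) ∧
      ∀ I : Finset (Fin n),
        (∀ i : Fin n,
          (ta i / w i > max (((∑ j ∈ I, w j * ta j) - M) / (∑ j ∈ I, w j ^ 2)) (τ * β)
            → i ∈ I) ∧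
          (ta i / w i < max (((∑ j ∈ I, w j * ta j) - M) / (∑ j ∈ I, w j ^ 2)) (τ * β)
            → i ∉ I)) →
        ∀ αstar : EuclideanSpace ℝ (Fin n),
          (∀ i : Fin n, αstar i
            = max 0 (ta i - w i *
                max (((∑ j ∈ I, w j * ta j) - M) / (∑ j ∈ I, w j ^ 2)) (τ * β))) →
          ∀ z : EuclideanSpace ℝ (Fin n), z ≠ αstar →
            ((1 / 2 * ‖αstar - ta‖ ^ 2 : ℝ) : EReal) + (τ : EReal) * R αstar
              < ((1 / 2 * ‖z - ta‖ ^ 2 : ℝ) : EReal) + (τ : EReal) * R z := by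
  have hc : 0 < τ * β := mul_pos hτ hβ
  have hW : ∀ I : Finset (Fin n), I.Nonempty → 0 < ∑ j ∈ I, w j ^ 2 := fun I hI =>
    Finset.sum_pos (fun j _ => pow_pos (hw j) 2) hI
  refine ⟨?_, fun I hI αstar hα z hz => ?_⟩
  · obtain ⟨l, hcl, hle, heq⟩ := exists_threshold w ta hw hM (τ * β)
    let I := Finset.univ.filter fun i => l < ta i / w i
    have hI : ∀ i, (ta i / w i > l → i ∈ I) ∧ (ta i / w i < l → i ∉ I) := fun i =>
      ⟨fun h => by simpa [I] using h, fun h => by simpa [I] using h.le⟩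
    rw [sum_mul_max_eq_of_consistent w ta hw I l hI] at hle heq
    suffices hl : max (((∑ j ∈ I, w j * ta j) - M) / (∑ j ∈ I, w j ^ 2)) (τ * β) = l from
      ⟨I, by rwa [hl]⟩
    rcases I.eq_empty_or_nonempty with h | h
    · rw [h] at heq ⊢
      have hcl' : τ * β = l := hcl.eq_of_not_lt fun h' => by
        have := heq h'
        simp at this
        linarith
      simpa [hcl'] using (hcl' ▸ hc).le
    · rcases hcl.eq_or_lt with h' | h'
      · rw [h', max_eq_right]
        rw [div_le_iff₀ (hW I h)]
        linarith
      · have : ((∑ j ∈ I, w j * ta j) - M) / (∑ j ∈ I, w j ^ 2) = l := by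
          rw [div_eq_iff (hW I h).ne']
          linarith [heq h']
        rw [this, max_eq_left hcl]
  · set l := max (((∑ j ∈ I, w j * ta j) - M) / (∑ j ∈ I, w j ^ 2)) (τ * β) with hl
    have hsum : ∑ i, w i * αstar i = ∑ i ∈ I, w i * ta i - l * ∑ i ∈ I, w i ^ 2 := by
      simp only [hα]
      exact sum_mul_max_eq_of_consistent w ta hw I l hI
    have hle : ∑ i, w i * αstar i ≤ M := by
      rw [hsum]
      rcases I.eq_empty_or_nonempty with h | h
      · simpa [h] using hM.le
      · have := (div_le_iff₀ (hW I h)).1 (hl ▸ le_max_left _ _)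
        linarith
    have hslack : τ * β < l → ∑ i, w i * αstar i = M := by
      intro h
      have hlA : l = ((∑ j ∈ I, w j * ta j) - M) / (∑ j ∈ I, w j ^ 2) := by
        rcases max_choice (((∑ j ∈ I, w j * ta j) - M) / (∑ j ∈ I, w j ^ 2)) (τ * β) with h' | h'
        · exact h'
        · exact absurd (hl.trans h') h.ne'
      rcases I.eq_empty_or_nonempty with hI' | hI'
      · rw [hI'] at hlA
        simp at hlA
        linarith
      · rw [eq_div_iff (hW I hI').ne'] at hlA
        linarith
    have hRα : R αstar = ((β * ∑ i, w i * αstar i : ℝ) : EReal) := by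
      rw [hR, if_pos ⟨fun i => hα i ▸ le_max_left _ _, hle⟩]
    rw [hRα, ← EReal.coe_mul, ← EReal.coe_add, hR z]
    split_ifs with hfeas
    · rw [← EReal.coe_mul, ← EReal.coe_add, EReal.coe_lt_coe_iff, ← mul_assoc, ← mul_assoc,
        EuclideanSpace.real_norm_sq_eq, EuclideanSpace.real_norm_sq_eq]
      exact objective_lt_of_complementary_slackness w ta αstar z hα (le_max_right _ _) hslack
        hfeas.1 hfeas.2 fun h => hz (PiLp.ext fun i => congrFun h i)
    · rw [EReal.coe_mul_top_of_pos hτ, EReal.coe_add_top]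
      exact EReal.coe_lt_top _
end

section
/- Let ε, δ, α₀, τ > 0 and n ≥ 1. Define g : (ℝ²)ⁿ → ℝ by g(y) := Σ_{j=1}^n [ max{0, (‖y_j‖ − α₀)³/(3ε)} + (δ/2)‖y_j‖² ], where y = (y₁, …, y_n) with y_j ∈ ℝ² and ‖·‖ the Euclidean norm on ℝ². Then for every v ∈ (ℝ²)ⁿ, the unique minimizer y of z ↦ (1/2)‖z − v‖² + τ·g(z) has components: y_j = v_j/(1 + τδ) if ‖v_j‖ < (1 + τδ)α₀, and otherwise y_j = t_j·v_j with t_j = (2α₀ − ε(τ⁻¹ + δ) + √(ε²(τ⁻¹ + δ)² + 4ε(τ⁻¹‖v_j‖ − (τ⁻¹ + δ)α₀))) / (2‖v_j‖). -/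
/-- The tangent-line inequality for the convex function `b ↦ max 0 ((b - α)³ / (3ε))`. -/
lemma max_cube_tangent_le {ε : ℝ} (hε : 0 < ε) (α a b : ℝ) :
    max 0 ((a - α) ^ 3 / (3 * ε)) + max 0 (a - α) ^ 2 / ε * (b - a)
      ≤ max 0 ((b - α) ^ 3 / (3 * ε)) := by
  rcases le_total a α with ha | ha
  · have h1 : (a - α) ^ 3 / (3 * ε) ≤ 0 :=
      div_nonpos_of_nonpos_of_nonneg (Odd.pow_nonpos (by decide) (by linarith)) (by positivity)
    rw [max_eq_left h1, max_eq_left (by linarith : a - α ≤ 0)]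
    simp
  · have h1 : 0 ≤ (a - α) ^ 3 / (3 * ε) :=
      div_nonneg (pow_nonneg (by linarith) 3) (by positivity)
    rw [max_eq_right h1, max_eq_right (by linarith : 0 ≤ a - α)]
    have h2 : (a - α) ^ 3 / (3 * ε) + (a - α) ^ 2 / ε * (b - a)
        = ((a - α) ^ 3 + 3 * (a - α) ^ 2 * (b - a)) / (3 * ε) := by
      field_simp
    rw [h2]
    obtain ⟨p, hp⟩ : ∃ p, p = a - α := ⟨_, rfl⟩
    obtain ⟨q, hq⟩ : ∃ q, q = b - α := ⟨_, rfl⟩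
    have hba : b - a = q - p := by rw [hp, hq]; ring
    have hp0 : 0 ≤ p := by linarith
    rw [hba, ← hp, ← hq]
    rcases le_total q 0 with hq0 | hq0
    · refine le_max_of_le_left (div_nonpos_of_nonpos_of_nonneg ?_ (by positivity))
      nlinarith [pow_nonneg hp0 3, mul_nonneg (sq_nonneg p) (neg_nonneg.2 hq0)]
    · refine le_max_of_le_right ?_
      gcongr
      nlinarith [mul_nonneg (by linarith : 0 ≤ q + 2 * p) (sq_nonneg (q - p))]

/-- If `v` is a multiple of `y` satisfying the optimality condition of the radial problem, then
`y` minimizes the proximal objective with quadratic growth. -/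
lemma prox_objective_quadratic_growth {E : Type*} [NormedAddCommGroup E] [InnerProductSpace ℝ E]
    {ε τ : ℝ} (hε : 0 < ε) (hτ : 0 < τ) (δ α m : ℝ) (hm : 0 ≤ m) (v y z : E)
    (hv : v = (1 + τ * δ + m) • y) (hmy : m * ‖y‖ = τ * (max 0 (‖y‖ - α) ^ 2 / ε)) :
    1 / 2 * ‖y - v‖ ^ 2 + τ * (max 0 ((‖y‖ - α) ^ 3 / (3 * ε)) + δ / 2 * ‖y‖ ^ 2)
        + (1 + τ * δ) / 2 * ‖z - y‖ ^ 2
      ≤ 1 / 2 * ‖z - v‖ ^ 2 + τ * (max 0 ((‖z‖ - α) ^ 3 / (3 * ε)) + δ / 2 * ‖z‖ ^ 2) := by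
  have h1 := mul_le_mul_of_nonneg_left (max_cube_tangent_le hε α ‖y‖ ‖z‖) hτ.le
  have h2 := mul_le_mul_of_nonneg_left (real_inner_le_norm z y) hm
  have h3 : τ * (max 0 (‖y‖ - α) ^ 2 / ε * (‖z‖ - ‖y‖)) = m * ‖y‖ * (‖z‖ - ‖y‖) := by
    rw [hmy]; ring
  have hyv := norm_sub_sq_real y v
  have hzv := norm_sub_sq_real z v
  have hzy := norm_sub_sq_real z y
  have i1 : inner ℝ y v = (1 + τ * δ + m) * ‖y‖ ^ 2 := by
    rw [hv, real_inner_smul_right, real_inner_self_eq_norm_sq]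
  have i2 : inner ℝ z v = (1 + τ * δ + m) * inner ℝ z y := by
    rw [hv, real_inner_smul_right]
  rw [i1] at hyv
  rw [i2] at hzv
  rw [hyv, hzv, hzy]
  rw [mul_add, h3] at h1
  linarith


/-- Lemma D.3: the proximal operator of the smoothed inner regulariser
`g*_{ε,δ}(y) = Σ_j max{0, (‖y_j‖ − α₀)³/(3ε)} + (δ/2)‖y_j‖²` on `(ℝ²)ⁿ`.
The unique minimizer `y` of `z ↦ (1/2)‖z − v‖² + τg(z)` has components
`y_j = v_j/(1 + τδ)` if `‖v_j‖ < (1 + τδ)α₀` and otherwise `y_j = t_j v_j` with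
`t_j = (2α₀ − ε(τ⁻¹ + δ) + √(ε²(τ⁻¹ + δ)² + 4ε(τ⁻¹‖v_j‖ − (τ⁻¹ + δ)α₀)))/(2‖v_j‖)`. -/
theorem prox_smoothed_inner_regulariser
    (ε δ α₀ τ : ℝ) (hε : 0 < ε) (hδ : 0 < δ) (hα₀ : 0 < α₀) (hτ : 0 < τ)
    (n : ℕ) (hn : 1 ≤ n)
    (g : PiLp 2 (fun _ : Fin n => EuclideanSpace ℝ (Fin 2)) → ℝ)
    (hg : ∀ y : PiLp 2 (fun _ : Fin n => EuclideanSpace ℝ (Fin 2)),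
      g y = ∑ j, (max 0 ((‖y j‖ - α₀) ^ 3 / (3 * ε)) + δ / 2 * ‖y j‖ ^ 2))
    (v y : PiLp 2 (fun _ : Fin n => EuclideanSpace ℝ (Fin 2)))
    (hy : ∀ j : Fin n,
      (‖v j‖ < (1 + τ * δ) * α₀ → y j = (1 + τ * δ)⁻¹ • v j) ∧
      (¬ ‖v j‖ < (1 + τ * δ) * α₀ →
        y j = ((2 * α₀ - ε * (τ⁻¹ + δ)
            + Real.sqrt (ε ^ 2 * (τ⁻¹ + δ) ^ 2
                + 4 * ε * (τ⁻¹ * ‖v j‖ - (τ⁻¹ + δ) * α₀))) / (2 * ‖v j‖)) • v j)) :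
    ∀ z : PiLp 2 (fun _ : Fin n => EuclideanSpace ℝ (Fin 2)), z ≠ y →
      1 / 2 * ‖y - v‖ ^ 2 + τ * g y < 1 / 2 * ‖z - v‖ ^ 2 + τ * g z := by
  have key : ∀ (j : Fin n) (w : EuclideanSpace ℝ (Fin 2)),
      1 / 2 * ‖y j - v j‖ ^ 2
          + τ * (max 0 ((‖y j‖ - α₀) ^ 3 / (3 * ε)) + δ / 2 * ‖y j‖ ^ 2)
          + (1 + τ * δ) / 2 * ‖w - y j‖ ^ 2
        ≤ 1 / 2 * ‖w - v j‖ ^ 2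
          + τ * (max 0 ((‖w‖ - α₀) ^ 3 / (3 * ε)) + δ / 2 * ‖w‖ ^ 2) := by
    intro j w
    have hk : 0 < 1 + τ * δ := by positivity
    by_cases hj : ‖v j‖ < (1 + τ * δ) * α₀
    · have hyj := (hy j).1 hj
      refine prox_objective_quadratic_growth hε hτ δ α₀ 0 le_rfl _ _ _ ?_ ?_
      · rw [hyj, add_zero, smul_inv_smul₀ hk.ne']
      · have hn : ‖y j‖ ≤ α₀ := by
          rw [hyj, norm_smul, norm_inv, Real.norm_of_nonneg hk.le, inv_mul_le_iff₀ hk]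
          exact hj.le
        rw [max_eq_left (by linarith : ‖y j‖ - α₀ ≤ 0)]
        simp
    · have hyj := (hy j).2 hj
      rw [not_lt] at hj
      have hr : 0 < ‖v j‖ := lt_of_lt_of_le (by positivity) hj
      obtain ⟨c, hc⟩ : ∃ c, c = τ⁻¹ + δ := ⟨_, rfl⟩
      have hτc : τ * c = 1 + τ * δ := by rw [hc]; field_simp
      have hc0 : 0 < c := by rw [hc]; positivity
      have hd : 0 ≤ τ⁻¹ * ‖v j‖ - c * α₀ := by
        have : τ⁻¹ * ‖v j‖ - c * α₀ = τ⁻¹ * (‖v j‖ - (1 + τ * δ) * α₀) := by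
          rw [← hτc]; field_simp
        rw [this]
        exact mul_nonneg (by positivity) (by linarith)
      rw [← hc] at hyj
      obtain ⟨R, hR⟩ : ∃ R, R = √(ε ^ 2 * c ^ 2 + 4 * ε * (τ⁻¹ * ‖v j‖ - c * α₀)) := ⟨_, rfl⟩
      have hR2 : R ^ 2 = ε ^ 2 * c ^ 2 + 4 * ε * (τ⁻¹ * ‖v j‖ - c * α₀) := by
        rw [hR]; exact Real.sq_sqrt (by positivity)
      have hRε : ε * c ≤ R := by
        rw [hR]
        refine Real.le_sqrt_of_sq_le ?_
        have : 0 ≤ 4 * ε * (τ⁻¹ * ‖v j‖ - c * α₀) := by positivity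
        linarith [mul_pow ε c 2]
      rw [← hR] at hyj
      obtain ⟨s, hs⟩ : ∃ s, s = (2 * α₀ - ε * c + R) / 2 := ⟨_, rfl⟩
      have hsα : α₀ ≤ s := by rw [hs]; linarith
      have hs0 : 0 < s := hα₀.trans_le hsα
      have hyj' : y j = (s / ‖v j‖) • v j := by
        rw [hyj, hs]; congr 1; field_simp
      have hyn : ‖y j‖ = s := by
        rw [hyj', norm_smul, Real.norm_of_nonneg (by positivity), div_mul_cancel₀ _ hr.ne']
      have hquad : ‖v j‖ = (1 + τ * δ) * s + τ * ((s - α₀) ^ 2 / ε) := by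
        have hRs : R = 2 * (s - α₀) + ε * c := by rw [hs]; ring
        rw [hRs] at hR2
        have h1 : ε * (τ⁻¹ * ‖v j‖) = (s - α₀) ^ 2 + ε * c * s := by linarith
        have h2 : ‖v j‖ = τ * (ε * (τ⁻¹ * ‖v j‖)) / ε := by field_simp
        rw [h2, h1, ← hτc]
        field_simp
        ring
      refine prox_objective_quadratic_growth hε hτ δ α₀ (τ * ((s - α₀) ^ 2 / ε) / s)
        (by positivity) _ _ _ ?_ ?_
      · have : 1 + τ * δ + τ * ((s - α₀) ^ 2 / ε) / s = ‖v j‖ / s := by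
          rw [hquad]; field_simp
        rw [this, hyj', smul_smul, div_mul_div_cancel₀ hs0.ne', div_self hr.ne', one_smul]
      · rw [hyn, max_eq_right (by linarith : 0 ≤ s - α₀), div_mul_cancel₀ _ hs0.ne']
  intro z hz
  have hpos : 0 < (1 + τ * δ) / 2 * ‖z - y‖ ^ 2 := by
    have := norm_pos_iff.2 (sub_ne_zero.2 hz)
    positivity
  have hsum := Finset.sum_le_sum fun j (_ : j ∈ Finset.univ) => key j (z j)
  simp only [Finset.sum_add_distrib, ← Finset.mul_sum] at hsum
  rw [hg, hg]
  rw [PiLp.norm_sq_eq_of_L2] at hpos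
  rw [PiLp.norm_sq_eq_of_L2, PiLp.norm_sq_eq_of_L2]
  simp only [Finset.sum_add_distrib, ← Finset.mul_sum, PiLp.sub_apply] at hpos ⊢
  linarith
end
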